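/- arXiv:2502.01086 — 3 statements merged into one kernel-verified Lean document; each statement's English description precedes it below -/
import Mathlib

section
/- For every positive integer n ≥ 8, there exists a 4-coloring of [n] with no rainbow 4-term arithmetic progression in which each color class has size at least ⌊n/4⌋ (in particular, when 4 divides n, an equinumerous such coloring exists). -/
inductive Color | A | B | C | D
  deriving DecidableEq

open Color

/-- A coloring `c` of `{1,...,n}` contains a rainbow 4-term AP. -/
def RainbowAP4 (n : ℕ) (c : ℕ → Color) : Prop :=
  ∃ t d : ℕ, 1 ≤ t ∧ 1 ≤ d ∧ t + 3*d ≤ n ∧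
    c t ≠ c (t+d) ∧ c t ≠ c (t+2*d) ∧ c t ≠ c (t+3*d) ∧
    c (t+d) ≠ c (t+2*d) ∧ c (t+d) ≠ c (t+3*d) ∧ c (t+2*d) ≠ c (t+3*d)

/-- The coloring that on odd numbers reads `A`, `C`, `B` with changes at `a`, `b`, and on even
numbers reads `D`, `A`, `D`, `B`, `D` with changes at `p`, `q`, `r`, `s`. -/
def thresholdColoring (a b p q r s i : ℕ) : Color :=
  if i % 2 = 1 then
    if i < a then A else if i < b then C else B
  else
    if i < p then D else if i < q then A else if i < r then D else if i < s then B else D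

section Thresholds

variable {a b p q r s i : ℕ}

theorem thresholdColoring_eq_A_iff :
    thresholdColoring a b p q r s i = A ↔
      i % 2 = 1 ∧ i < a ∨ i % 2 = 0 ∧ p ≤ i ∧ i < q := by
  unfold thresholdColoring
  split_ifs <;> simp <;> omega

theorem thresholdColoring_eq_B_iff (hab : a ≤ b) (hpq : p ≤ q) (hqr : q ≤ r) :
    thresholdColoring a b p q r s i = B ↔
      i % 2 = 1 ∧ b ≤ i ∨ i % 2 = 0 ∧ r ≤ i ∧ i < s := by
  unfold thresholdColoring
  split_ifs <;> simp <;> omega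

theorem thresholdColoring_eq_C_iff :
    thresholdColoring a b p q r s i = C ↔ i % 2 = 1 ∧ a ≤ i ∧ i < b := by
  unfold thresholdColoring
  split_ifs <;> simp <;> omega

theorem thresholdColoring_eq_D_iff (hqr : q ≤ r) :
    thresholdColoring a b p q r s i = D ↔
      i % 2 = 0 ∧ (i < p ∨ q ≤ i ∧ i < r ∨ s ≤ i ∧ r ≤ i) := by
  unfold thresholdColoring
  split_ifs <;> simp <;> omega

end Thresholds

/-- A rainbow progression attains each color at one of its terms. -/
theorem exists_index_of_rainbow {c₀ c₁ c₂ c₃ : Color} (h₀₁ : c₀ ≠ c₁) (h₀₂ : c₀ ≠ c₂)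
    (h₀₃ : c₀ ≠ c₃) (h₁₂ : c₁ ≠ c₂) (h₁₃ : c₁ ≠ c₃) (h₂₃ : c₂ ≠ c₃) (x : Color) :
    c₀ = x ∨ c₁ = x ∨ c₂ = x ∨ c₃ = x := by
  cases c₀ <;> cases c₁ <;> cases c₂ <;> cases c₃ <;> cases x <;> simp_all

/-- Inequalities between the thresholds that rule out rainbow 4-term progressions. -/
theorem not_rainbowAP4_thresholdColoring {n a b p q r s : ℕ}
    (ha : a % 2 = 1) (hb : b % 2 = 1) (hp : p % 2 = 0) (hq : q % 2 = 0) (hr : r % 2 = 0)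
    (hs : s % 2 = 0) (hn : n % 2 = 0)
    (hab : a ≤ b) (hpq : p ≤ q) (hqr : q ≤ r)
    (harb : a + b ≤ 2 * r + 2) (haqb : 2 * q ≤ a + b + 2)
    (h₁ : 3 * p ≤ r + 6) (h₂ : s + 2 * a ≤ 3 * q + 4)
    (h₃ : q + 2 * n ≤ 3 * s + 2) (h₄ : 3 * r ≤ p + 2 * b + 4) :
    ¬ RainbowAP4 n (thresholdColoring a b p q r s) := by
  rintro ⟨t, d, ht, hd, htn, h₀₁, h₀₂, h₀₃, h₁₂, h₁₃, h₂₃⟩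
  have hA := exists_index_of_rainbow h₀₁ h₀₂ h₀₃ h₁₂ h₁₃ h₂₃ A
  have hB := exists_index_of_rainbow h₀₁ h₀₂ h₀₃ h₁₂ h₁₃ h₂₃ B
  have hC := exists_index_of_rainbow h₀₁ h₀₂ h₀₃ h₁₂ h₁₃ h₂₃ C
  have hD := exists_index_of_rainbow h₀₁ h₀₂ h₀₃ h₁₂ h₁₃ h₂₃ D
  simp only [thresholdColoring_eq_A_iff] at hA
  simp only [thresholdColoring_eq_B_iff hab hpq hqr] at hB
  simp only [thresholdColoring_eq_C_iff] at hC
  simp only [thresholdColoring_eq_D_iff hqr] at hD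
  clear h₀₁ h₀₂ h₀₃ h₁₂ h₁₃ h₂₃
  rcases hC with hC | hC | hC | hC <;> rcases hD with hD | hD | hD | hD <;> omega

/-- The number of `i ∈ [n]` of color `x`. -/
def colorCount (c : ℕ → Color) (n : ℕ) (x : Color) : ℕ :=
  ((Finset.Icc 1 n).filter (fun i => c i = x)).card

theorem colorCount_eq_sum (c : ℕ → Color) (n : ℕ) (x : Color) :
    colorCount c n x = ∑ i ∈ Finset.range n, if c (i + 1) = x then 1 else 0 := by
  rw [colorCount, Finset.card_filter, Finset.range_eq_Ico,
    Finset.sum_Ico_add' (fun i => if c i = x then 1 else 0)]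
  rfl

theorem colorCount_succ (c : ℕ → Color) (n : ℕ) (x : Color) :
    colorCount c (n + 1) x = colorCount c n x + if c (n + 1) = x then 1 else 0 := by
  simp only [colorCount_eq_sum, Finset.sum_range_succ]

theorem colorCount_shift (c : ℕ → Color) (n : ℕ) (x : Color) :
    colorCount c (n + 1) x
      = colorCount (fun i => c (i + 1)) n x + if c 1 = x then 1 else 0 := by
  simp only [colorCount_eq_sum, Finset.sum_range_succ']

theorem colorCount_two_mul (c : ℕ → Color) (m : ℕ) (x : Color) :
    colorCount c (2 * m) x
      = ((Finset.range m).filter (fun j => c (2 * j + 1) = x)).card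
        + ((Finset.range m).filter (fun j => c (2 * j + 2) = x)).card := by
  simp only [colorCount_eq_sum, Finset.card_filter]
  induction m with
  | zero => simp
  | succ m ih =>
    rw [mul_add, mul_one, Finset.sum_range_succ, Finset.sum_range_succ, ih,
      Finset.sum_range_succ, Finset.sum_range_succ]
    ring

theorem RainbowAP4.mono {m n : ℕ} {c : ℕ → Color} (hmn : m ≤ n) (h : RainbowAP4 m c) :
    RainbowAP4 n c := by
  obtain ⟨t, d, ht, hd, htn, h⟩ := h
  exact ⟨t, d, ht, hd, htn.trans hmn, h⟩

theorem RainbowAP4.of_shift {n : ℕ} {c : ℕ → Color}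
    (h : RainbowAP4 n (fun i => c (i + 1))) : RainbowAP4 (n + 1) c := by
  obtain ⟨t, d, ht, hd, htn, h⟩ := h
  refine ⟨t + 1, d, by omega, hd, by omega, ?_⟩
  simpa only [add_right_comm t 1] using h

theorem card_filter_range_eq_of_iff_Ico {m u v : ℕ} {P : ℕ → Prop} [DecidablePred P]
    (hv : v ≤ m) (h : ∀ j < m, P j ↔ u ≤ j ∧ j < v) :
    ((Finset.range m).filter P).card = v - u := by
  rw [← Nat.card_Ico]
  congr 1
  ext j
  simp only [Finset.mem_filter, Finset.mem_range, Finset.mem_Ico]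
  constructor
  · rintro ⟨hj, hP⟩
    exact (h j hj).1 hP
  · intro hj
    exact ⟨by omega, (h j (by omega)).2 hj⟩

theorem sum_colorCount (c : ℕ → Color) (n : ℕ) :
    colorCount c n A + colorCount c n B + colorCount c n C + colorCount c n D = n := by
  induction n with
  | zero => simp [colorCount]
  | succ n ih =>
    simp only [colorCount_succ]
    cases c (n + 1) <;> simp <;> omega

/-- For every `k ≥ 2` there is a rainbow-free equinumerous coloring of `[4 * k]`, which can
moreover be chosen so that its first and its last two terms have colors `A`, `B` and `D`. -/
theorem exists_equinumerous_coloring (k : ℕ) (hk : 2 ≤ k) :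
    ∃ c : ℕ → Color, ¬ RainbowAP4 (4 * k) c ∧ (∀ x, colorCount c (4 * k) x = k) ∧
      c 1 = A ∧ c (4 * k - 1) = B ∧ c (4 * k) = D := by
  obtain ⟨u, hu⟩ : ∃ u, u = (k / 2 + (k + 1) / 4 + 1) / 2 := ⟨_, rfl⟩
  obtain ⟨v, hv⟩ : ∃ v, v = (k + 1) / 4 := ⟨_, rfl⟩
  obtain ⟨β, hβ⟩ : ∃ β, β = k / 2 := ⟨_, rfl⟩
  obtain ⟨α, hα⟩ : ∃ α, α + β = k := ⟨k - β, by omega⟩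
  have hw : u + v < k := by omega
  have hαv : 3 * α ≤ 2 * u + 2 * v + β + 2 := by
    rcases lt_or_ge k 8 with hk' | hk'
    · interval_cases k <;> omega
    · omega
  obtain ⟨c, hc⟩ : ∃ c, c = thresholdColoring (2 * α + 1) (2 * (k + α) + 1) (2 * u + 2)
    (2 * (u + β) + 2) (2 * (u + β + v) + 2) (2 * (u + k + v) + 2) := ⟨_, rfl⟩
  refine ⟨c, ?_, ?_, ?_, ?_, ?_⟩
  · rw [hc]
    apply not_rainbowAP4_thresholdColoring <;> omega
  · have hA : colorCount c (4 * k) A = k := by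
      rw [show 4 * k = 2 * (2 * k) by ring, colorCount_two_mul]
      simp only [hc, thresholdColoring_eq_A_iff]
      rw [card_filter_range_eq_of_iff_Ico (u := 0) (v := α),
        card_filter_range_eq_of_iff_Ico (u := u) (v := u + β)] <;> omega
    have hB : colorCount c (4 * k) B = k := by
      rw [show 4 * k = 2 * (2 * k) by ring, colorCount_two_mul]
      simp only [hc, thresholdColoring_eq_B_iff (show 2 * α + 1 ≤ 2 * (k + α) + 1 by omega)
        (show 2 * u + 2 ≤ 2 * (u + β) + 2 by omega)
        (show 2 * (u + β) + 2 ≤ 2 * (u + β + v) + 2 by omega)]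
      rw [card_filter_range_eq_of_iff_Ico (u := k + α) (v := 2 * k),
        card_filter_range_eq_of_iff_Ico (u := u + β + v) (v := u + k + v)] <;> omega
    have hC : colorCount c (4 * k) C = k := by
      rw [show 4 * k = 2 * (2 * k) by ring, colorCount_two_mul]
      simp only [hc, thresholdColoring_eq_C_iff]
      rw [card_filter_range_eq_of_iff_Ico (u := α) (v := k + α),
        card_filter_range_eq_of_iff_Ico (u := 0) (v := 0)] <;> omega
    have hsum := sum_colorCount c (4 * k)
    rintro (_ | _ | _ | _) <;> omega
  · rw [hc, thresholdColoring_eq_A_iff]; omega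
  · rw [hc, thresholdColoring_eq_B_iff] <;> omega
  · rw [hc, thresholdColoring_eq_D_iff] <;> omega

theorem stmt_10 (n : ℕ) (hn : 8 ≤ n) :
    ∃ c : ℕ → Color, ¬ RainbowAP4 n c ∧
      (∀ x : Color, n / 4 ≤ ((Finset.Icc 1 n).filter (fun i => c i = x)).card) ∧
      (4 ∣ n → ∀ x : Color, ((Finset.Icc 1 n).filter (fun i => c i = x)).card = n / 4) := by
  change ∃ c : ℕ → Color, ¬ RainbowAP4 n c ∧ (∀ x, n / 4 ≤ colorCount c n x) ∧
    (4 ∣ n → ∀ x, colorCount c n x = n / 4)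
  obtain ⟨c, hc, hcount, h_first, h_penult, h_last⟩ :=
    exists_equinumerous_coloring ((n + 3) / 4) (by omega)
  obtain ⟨m, hm⟩ : ∃ m, (n + 3) / 4 = m + 1 := ⟨(n + 3) / 4 - 1, by omega⟩
  rw [hm] at hc hcount h_penult h_last
  have h_count (x : Color) :
      colorCount (fun i => c (i + 1)) (4 * m + 1) x + (if c 1 = x then 1 else 0)
        = colorCount c (4 * m + 2) x ∧
      colorCount c (4 * m + 2) x + (if B = x then 1 else 0) = colorCount c (4 * m + 3) x ∧
      colorCount c (4 * m + 3) x + (if D = x then 1 else 0) = m + 1 := by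
    refine ⟨(colorCount_shift c _ x).symm, ?_, ?_⟩
    · rw [← h_penult]
      exact (colorCount_succ c _ x).symm
    · rw [← h_last]
      exact (colorCount_succ c _ x).symm.trans (hcount x)
  have hcases : n = 4 * m + 1 ∨ n = 4 * m + 2 ∨ n = 4 * m + 3 ∨ n = 4 * (m + 1) := by omega
  rw [h_first] at h_count
  rcases hcases with rfl | rfl | rfl | rfl
  · refine ⟨fun i => c (i + 1), fun h => hc (h.of_shift.mono (by omega)), fun x => ?_, by omega⟩
    have := h_count x
    cases x <;> simp at this <;> omega
  · refine ⟨c, fun h => hc (h.mono (by omega)), fun x => ?_, by omega⟩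
    have := h_count x
    cases x <;> simp at this <;> omega
  · refine ⟨c, fun h => hc (h.mono (by omega)), fun x => ?_, by omega⟩
    have := h_count x
    cases x <;> simp at this <;> omega
  · refine ⟨c, hc, fun x => ?_, fun _ x => ?_⟩ <;> rw [hcount x] <;> omega
end

section
/- For every integer k ≥ 4 and every n > 1, there exists an equinumerous k-coloring of [kn] that contains no rainbow k-term arithmetic progression. -/
/-- A coloring `c` of `{1,...,N}` with `k` colors contains a rainbow `k`-term AP. -/
def RainbowAPk (k N : ℕ) (c : ℕ → Fin k) : Prop :=
  ∃ a d : ℕ, 1 ≤ a ∧ 1 ≤ d ∧ a + (k-1)*d ≤ N ∧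
    ∀ i j : Fin k, i ≠ j → c (a + (i : ℕ)*d) ≠ c (a + (j : ℕ)*d)

/-- The coloring whose restriction to `[4, 8m+3]` is `(DDCA)^m (CABB)^m`, extended by one `D` on the
left and by `CAB` on the right; the colors `A`, `B`, `C`, `D` are `0`, `1`, `2`, `3`. -/
def blockColor (m j : ℕ) : ℕ :=
  if j = 3 then 3
  else if j < 4 * m + 4 then
    if j % 4 = 2 then 2 else if j % 4 = 3 then 0 else 3
  else
    if j % 4 = 0 then 2 else if j % 4 = 1 then 0 else 1

theorem blockColor_lt (m j : ℕ) : blockColor m j < 4 := by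
  unfold blockColor
  split_ifs <;> omega

theorem blockColor_not_rainbow (m j d : ℕ) (hm : 1 ≤ m) (hd : 1 ≤ d) (hj : 3 ≤ j)
    (hjd : j + 3 * d ≤ 8 * m + 6)
    (h01 : blockColor m j ≠ blockColor m (j + d))
    (h02 : blockColor m j ≠ blockColor m (j + 2 * d))
    (h03 : blockColor m j ≠ blockColor m (j + 3 * d))
    (h12 : blockColor m (j + d) ≠ blockColor m (j + 2 * d))
    (h13 : blockColor m (j + d) ≠ blockColor m (j + 3 * d))
    (h23 : blockColor m (j + 2 * d) ≠ blockColor m (j + 3 * d)) : False := by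
  unfold blockColor at *
  have h1 : j + d ≠ 3 := by omega
  have h2 : j + 2 * d ≠ 3 := by omega
  have h3 : j + 3 * d ≠ 3 := by omega
  simp only [h1, h2, h3, if_false] at *
  have hj4 : j % 4 = 0 ∨ j % 4 = 1 ∨ j % 4 = 2 ∨ j % 4 = 3 := by omega
  have hd4 : d % 4 = 0 ∨ d % 4 = 1 ∨ d % 4 = 2 ∨ d % 4 = 3 := by omega
  have e1 : (j + d) % 4 = (j % 4 + d % 4) % 4 := by omega
  have e2 : (j + 2 * d) % 4 = (j % 4 + 2 * (d % 4)) % 4 := by omega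
  have e3 : (j + 3 * d) % 4 = (j % 4 + 3 * (d % 4)) % 4 := by omega
  simp only [e1, e2, e3] at *
  have hj3 : (j = 3 ∧ (j = 3) = True) ∨ (j ≠ 3 ∧ (j = 3) = False) := by
    simpa using em (j = 3)
  by_cases t0 : j < 4 * m + 4 <;> by_cases t1 : j + d < 4 * m + 4 <;>
    by_cases t2 : j + 2 * d < 4 * m + 4 <;> by_cases t3 : j + 3 * d < 4 * m + 4 <;>
    first
    | omega
    | (rcases hj3 with ⟨j3, c⟩ | ⟨j3, c⟩ <;>
        rcases hj4 with a | a | a | a <;> rcases hd4 with b | b | b | b <;>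
        first
        | omega
        | simp [t0, t1, t2, t3, a, b, c] at h01 h02 h03 h12 h13 h23)

/-- The equinumerous coloring of `[kn]`: a block coloring on `[4n]`, then `n` consecutive elements
in each further color. -/
def extendedColor (n i : ℕ) : ℕ :=
  if i ≤ 4 * n then blockColor (n / 2) (i + 3 - n % 2) else (i - 1) / n

theorem extendedColor_lt {k n i : ℕ} (hk : 4 ≤ k) (hi : i ∈ Finset.Icc 1 (k * n)) :
    extendedColor n i < k := by
  rw [Finset.mem_Icc] at hi
  unfold extendedColor
  split_ifs
  · exact (blockColor_lt _ _).trans_le hk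
  · exact Nat.div_lt_of_lt_mul (by rw [mul_comm n k]; omega)

theorem four_le_extendedColor {n i : ℕ} (hn : 1 < n) (hi : 4 * n < i) :
    4 ≤ extendedColor n i := by
  unfold extendedColor
  rw [if_neg (by omega), Nat.le_div_iff_mul_le (by omega)]
  omega

theorem extendedColor_not_rainbow {n a d : ℕ} (hn : 1 < n) (ha : 1 ≤ a) (hd : 1 ≤ d)
    (had : a + 3 * d ≤ 4 * n)
    (h : ∀ i j : ℕ, i < 4 → j < 4 → i ≠ j →
      extendedColor n (a + i * d) ≠ extendedColor n (a + j * d)) : False := by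
  have e : ∀ i < 4, extendedColor n (a + i * d) =
      blockColor (n / 2) (a + 3 - n % 2 + i * d) := by
    intro i hi
    have : i * d ≤ 3 * d := Nat.mul_le_mul_right d (by omega)
    rw [extendedColor, if_pos (by omega)]
    congr 1
    omega
  have h' : ∀ i j : ℕ, i < 4 → j < 4 → i ≠ j →
      blockColor (n / 2) (a + 3 - n % 2 + i * d) ≠
        blockColor (n / 2) (a + 3 - n % 2 + j * d) := by
    intro i j hi hj hij
    rw [← e i hi, ← e j hj]
    exact h i j hi hj hij
  have h01 := h' 0 1 (by omega) (by omega) (by omega)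
  have h02 := h' 0 2 (by omega) (by omega) (by omega)
  have h03 := h' 0 3 (by omega) (by omega) (by omega)
  have h12 := h' 1 2 (by omega) (by omega) (by omega)
  have h13 := h' 1 3 (by omega) (by omega) (by omega)
  have h23 := h' 2 3 (by omega) (by omega) (by omega)
  simp only [zero_mul, one_mul, add_zero] at h01 h02 h03 h12 h13
  exact blockColor_not_rainbow (n / 2) (a + 3 - n % 2) d (by omega) hd (by omega) (by omega)
    h01 h02 h03 h12 h13 h23

/-- The `s`-th element of the color class `x < 4` of `blockColor m`. -/
def blockElement (m x s : ℕ) : ℕ :=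
  if x = 0 then if s < m then 4 * s + 7 else 4 * s + 5
  else if x = 1 then 4 * m + 6 + 4 * (s / 2) + s % 2
  else if x = 2 then if s < m then 4 * s + 6 else 4 * s + 4
  else if s < 2 * m then 4 + 4 * (s / 2) + s % 2 else 3

theorem blockColor_blockElement {m x s : ℕ} (hx : x < 4) :
    blockColor m (blockElement m x s) = x := by
  unfold blockElement
  split_ifs <;> unfold blockColor <;> split_ifs <;> omega

theorem blockElement_mem {m x s r : ℕ} (hs : s < 2 * m + r) (hr : r < 2) :
    4 - r ≤ blockElement m x s ∧ blockElement m x s ≤ 8 * m + 3 + 3 * r := by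
  unfold blockElement
  split_ifs <;> omega

/-- The `s`-th element of the color class `x` of `extendedColor n`. -/
def classElement (n x s : ℕ) : ℕ :=
  if x < 4 then blockElement (n / 2) x s + n % 2 - 3 else x * n + s + 1

theorem classElement_injOn (n x : ℕ) : Set.InjOn (classElement n x) (Finset.range n) := by
  intro s hs t ht hst
  simp only [Finset.coe_range, Set.mem_Iio] at hs ht
  unfold classElement blockElement at hst
  split_ifs at hst <;> omega

theorem classElement_mem {k n x s : ℕ} (hk : 4 ≤ k) (hx : x < k) (hs : s < n) :
    classElement n x s ∈ Finset.Icc 1 (k * n) := by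
  rw [Finset.mem_Icc]
  have h4 : 4 * n ≤ k * n := Nat.mul_le_mul_right n hk
  have hxn : (x + 1) * n ≤ k * n := Nat.mul_le_mul_right n hx
  rw [add_mul] at hxn
  have hb := blockElement_mem (m := n / 2) (x := x) (s := s) (r := n % 2) (by omega) (by omega)
  unfold classElement
  split_ifs <;> omega

theorem extendedColor_classElement {n x s : ℕ} (hs : s < n) :
    extendedColor n (classElement n x s) = x := by
  by_cases hx : x < 4
  · have hle : classElement n x s ≤ 4 * n :=
      (Finset.mem_Icc.1 (classElement_mem le_rfl hx hs)).2
    have hb := blockElement_mem (m := n / 2) (x := x) (s := s) (r := n % 2) (by omega) (by omega)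
    rw [extendedColor, if_pos hle, classElement, if_pos hx,
      show blockElement (n / 2) x s + n % 2 - 3 + 3 - n % 2 = blockElement (n / 2) x s by omega,
      blockColor_blockElement hx]
  · have hxn : 4 * n ≤ x * n := Nat.mul_le_mul_right n (by omega)
    rw [classElement, if_neg hx, extendedColor, if_neg (by omega), Nat.add_sub_cancel, mul_comm,
      Nat.mul_add_div (by omega), Nat.div_eq_of_lt hs, add_zero]

theorem stmt_11 (k n : ℕ) (hk : 4 ≤ k) (hn : 1 < n) :
    ∃ c : ℕ → Fin k,
      (∀ x : Fin k, ((Finset.Icc 1 (k*n)).filter (fun i => c i = x)).card = n) ∧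
      ¬ RainbowAPk k (k*n) c := by
  have hk0 : 0 < k := by omega
  let c : ℕ → Fin k := fun i => ⟨extendedColor n i % k, Nat.mod_lt _ hk0⟩
  have hc : ∀ i ∈ Finset.Icc 1 (k * n), (c i : ℕ) = extendedColor n i := fun i hi =>
    Nat.mod_eq_of_lt (extendedColor_lt hk hi)
  refine ⟨c, ?_, ?_⟩
  · have hle : ∀ x ∈ (Finset.univ : Finset (Fin k)),
        n ≤ ((Finset.Icc 1 (k * n)).filter (fun i => c i = x)).card := by
      intro x _
      conv_lhs => rw [← Finset.card_range n]
      refine Finset.card_le_card_of_injOn (classElement n x) ?_ (classElement_injOn n x)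
      intro s hs
      have hs' : s < n := by simpa using hs
      have hmem := classElement_mem hk x.2 hs'
      simp only [Finset.coe_filter, Set.mem_ofPred_eq]
      exact ⟨hmem, Fin.ext ((hc _ hmem).trans (extendedColor_classElement hs'))⟩
    have hsum : ∑ _x : Fin k, n =
        ∑ x : Fin k, ((Finset.Icc 1 (k * n)).filter (fun i => c i = x)).card := by
      rw [← Finset.card_eq_sum_card_fiberwise (fun i _ => Finset.mem_coe.2 (Finset.mem_univ (c i)))]
      simp
    intro x
    exact ((Finset.sum_eq_sum_iff_of_le hle).1 hsum x (Finset.mem_univ x)).symm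
  · rintro ⟨a, d, ha, hd, had, h⟩
    have hmem : ∀ i < k, a + i * d ∈ Finset.Icc 1 (k * n) := by
      intro i hi
      have : i * d ≤ (k - 1) * d := Nat.mul_le_mul_right d (by omega)
      rw [Finset.mem_Icc]
      omega
    have hne : ∀ i j : ℕ, i < k → j < k → i ≠ j →
        extendedColor n (a + i * d) ≠ extendedColor n (a + j * d) := by
      intro i j hi hj hij he
      refine h ⟨i, hi⟩ ⟨j, hj⟩ (by simpa using hij) (Fin.ext ?_)
      rw [hc _ (hmem i hi), hc _ (hmem j hj), he]
    by_cases h3 : a + 3 * d ≤ 4 * n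
    · exact extendedColor_not_rainbow hn ha hd h3 fun i j hi hj hij =>
        hne i j (by omega) (by omega) hij
    · have hcard : (Finset.Ico 4 k).card < (Finset.Ico 3 k).card := by
        simp only [Nat.card_Ico]
        omega
      obtain ⟨i, hi, j, hj, hij, he⟩ := Finset.exists_ne_map_eq_of_card_lt_of_maps_to
        (f := fun i => extendedColor n (a + i * d)) hcard (by
          intro i hi
          have hi' : 3 ≤ i ∧ i < k := by simpa using hi
          have : 3 * d ≤ i * d := Nat.mul_le_mul_right d hi'.1
          rw [Finset.mem_coe, Finset.mem_Ico]
          exact ⟨four_le_extendedColor hn (by omega), extendedColor_lt hk (hmem i hi'.2)⟩)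
      exact hne i j (Finset.mem_Ico.1 hi).2 (Finset.mem_Ico.1 hj).2 hij he
end

section
/- For positive integers k ≥ 3 and n > 1, it holds that every equinumerous k-coloring of [kn] contains a rainbow k-term arithmetic progression if and only if k = 3; in particular, for every k ≥ 4 and n > 1 there is an equinumerous k-coloring of [kn] with no rainbow AP(k), while every equinumerous 3-coloring of [3n] contains a rainbow AP(3). -/
/-- No three-term progression inside `[lo, hi]` is rainbow under `c`. -/
def RainbowFree (c : ℤ → Fin 3) (lo hi : ℤ) : Prop :=
  ∀ x y z, lo ≤ x → x ≤ hi → lo ≤ z → z ≤ hi → x + z = 2 * y →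
    c x = c y ∨ c y = c z ∨ c x = c z

namespace RainbowFree

variable {c : ℤ → Fin 3} {lo hi : ℤ}

lemma mid (h : RainbowFree c lo hi) {x z : ℤ} (y : ℤ) (hxz : c x ≠ c z) (hy : x + z = 2 * y)
    (hb : (lo ≤ x ∧ x ≤ hi) ∧ lo ≤ z ∧ z ≤ hi) : c y = c x ∨ c y = c z := by
  rcases h x y z hb.1.1 hb.1.2 hb.2.1 hb.2.2 hy with h | h | h
  · exact Or.inl h.symm
  · exact Or.inr h
  · exact absurd h hxz

/-- If the midpoint has another colour than one endpoint, the other endpoint has one of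
these two colours. -/
lemma endpoint (h : RainbowFree c lo hi) {x y : ℤ} (z : ℤ) (hxy : c x ≠ c y)
    (hy : x + z = 2 * y)
    (hb : (lo ≤ x ∧ x ≤ hi) ∧ lo ≤ z ∧ z ≤ hi) : c z = c x ∨ c z = c y := by
  rcases h x y z hb.1.1 hb.1.2 hb.2.1 hb.2.2 hy with h | h | h
  · exact absurd h hxy
  · exact Or.inr h.symm
  · exact Or.inl h.symm

lemma comp_affine (h : RainbowFree c lo hi) {lo' hi' : ℤ} (u s : ℤ)
    (hr : ∀ t, lo' ≤ t → t ≤ hi' → lo ≤ u + s * t ∧ u + s * t ≤ hi) :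
    RainbowFree (fun t => c (u + s * t)) lo' hi' := by
  intro x y z hx hx' hz hz' hy
  refine h _ _ _ (hr x hx hx').1 (hr x hx hx').2 (hr z hz hz').1 (hr z hz hz').2 ?_
  linear_combination s * hy

lemma not_extendable_odd_gap {f : ℤ → Fin 3} {L : ℤ} (hL : Odd L) (h1L : 1 < L)
    (h : RainbowFree f 0 (L + 1)) (h0 : f L = f 0)
    (hint : ∀ t, 0 < t → t < L → f t ≠ f 0) (hne : f 1 ≠ f (L - 1)) : False := by
  obtain ⟨m, hm⟩ := hL
  have dbl : ∀ t, 0 < t → 2 * t < L → f (2 * t) = f t := fun t ht ht' => by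
    have := h.endpoint (x := 0) (y := t) (2 * t) (hint t ht (by omega)).symm (by ring) (by omega)
    exact this.resolve_left (hint _ (by omega) ht')
  have dblL : ∀ t, 0 < 2 * t - L → t < L → f (2 * t - L) = f t := fun t ht ht' => by
    have := h.endpoint (x := L) (y := t) (2 * t - L)
      (by rw [h0]; exact (hint t (by omega) ht').symm)
      (by ring) (by omega)
    rw [h0] at this
    exact this.resolve_left (hint _ ht (by omega))
  have hw := h.endpoint (x := L - 1) (y := L) (L + 1)
    (by rw [h0]; exact hint _ (by omega) (by omega)) (by ring) (by omega)
  rcases hw with hw | hw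
  · have h1 := h.mid (x := 0) (z := L + 1) (m + 1)
      (by rw [hw]; exact (hint _ (by omega) (by omega)).symm) (by omega) (by omega)
    have h2 := h1.resolve_left (hint _ (by omega) (by omega))
    have h3 := dblL (m + 1) (by omega) (by omega)
    rw [show 2 * (m + 1) - L = 1 by omega] at h3
    exact hne (by rw [h3, h2, hw])
  · rw [h0] at hw
    have dblL' : ∀ t, 0 < 2 * t - L - 1 → t < L → f (2 * t - L - 1) = f t := fun t ht ht' => by
      have := h.endpoint (x := L + 1) (y := t) (2 * t - L - 1)
        (by rw [hw]; exact (hint t (by omega) ht').symm) (by ring) (by omega)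
      rw [hw] at this
      exact this.resolve_left (hint _ ht (by omega))
    have key : ∀ n : ℕ, ∀ t : ℤ, t = n → 0 < t → t < L → f t = f 1 := by
      intro n
      induction n using Nat.strong_induction_on with
      | _ n ih =>
        intro t htn ht ht'
        rcases Int.even_or_odd' t with ⟨r, hr | hr⟩
        · rw [hr, dbl r (by omega) (by omega)]
          exact ih r.toNat (by omega) r (by omega) (by omega) (by omega)
        · by_cases h1 : t = 1
          · rw [h1]
          · have e1 := dblL (r + m + 1) (by omega) (by omega)
            have e2 := dblL' (r + m + 1) (by omega) (by omega)
            rw [show 2 * (r + m + 1) - L = t by omega] at e1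
            rw [show 2 * (r + m + 1) - L - 1 = t - 1 by omega] at e2
            rw [e1, ← e2]
            exact ih (t - 1).toNat (by omega) _ (by omega) (by omega) (by omega)
    exact hne (key (L - 1).toNat (L - 1) (by omega) (by omega) (by omega)).symm

lemma exists_odd_stride (h : RainbowFree c lo hi) {u v : ℤ} (hu : lo ≤ u) (huv : u < v)
    (hv : v ≤ hi) (huv' : c v = c u) (hint : ∀ x, u < x → x < v → c x ≠ c u) :
    ∀ (L : ℕ) (s : ℤ), 0 < s → v = u + s * L → c (u + s) ≠ c (v - s) →
      ∃ (L' : ℕ) (s' : ℤ), 0 < s' ∧ Odd L' ∧ v = u + s' * L' ∧ c (u + s') ≠ c (v - s') := by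
  intro L
  induction L using Nat.strong_induction_on with
  | _ L ih =>
    intro s hs hvs hne
    rcases Nat.even_or_odd' L with ⟨m, hm | hm⟩
    · rcases Nat.lt_or_ge m 2 with hm2 | hm2
      · interval_cases m
        · simp [hm] at hvs; omega
        · exact absurd (by rw [hvs, hm]; congr 1; push_cast; ring) hne
      · have hm2' : (2 : ℤ) ≤ m := by exact_mod_cast hm2
        have hvm : v = u + 2 * s * m := by rw [hvs, hm]; push_cast; ring
        have hlt : u + 2 * s < v := by nlinarith
        have e1 := (h.endpoint (x := u) (y := u + s) (u + 2 * s)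
          (hint _ (by omega) (by omega)).symm (by ring) (by omega)).resolve_left
          (hint _ (by omega) (by omega))
        have e2 := (h.endpoint (x := v) (y := v - s) (v - 2 * s)
          (by rw [huv']; exact (hint _ (by omega) (by omega)).symm)
              (by ring) (by omega)).resolve_left
          (by rw [huv']; exact hint _ (by omega) (by omega))
        exact ih m (by omega) (2 * s) (by omega) hvm (by rw [e1, e2]; exact hne)
    · exact ⟨L, s, hs, ⟨m, hm⟩, hvs, hne⟩

/-- A gap between consecutive elements of one colour whose two ends are coloured differently
is part of a long progression that cannot be extended inside `[lo, hi]`. -/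
lemma exists_stride_of_gap (h : RainbowFree c lo hi) {u v : ℤ} (hu : lo ≤ u) (huv : u < v)
    (hv : v ≤ hi) (huv' : c v = c u) (hint : ∀ x, u < x → x < v → c x ≠ c u)
    (hne : c (u + 1) ≠ c (v - 1)) :
    ∃ s, u + 7 * s ≤ v ∧ u - s < lo ∧ hi < v + s := by
  obtain ⟨L, s, hs, hL, hvs, hne'⟩ := h.exists_odd_stride hu huv hv huv' hint (v - u).toNat 1
    one_pos (by omega) hne
  have hpos : ∀ t : ℤ, 0 < t → 0 < s * t := fun t ht => mul_pos hs ht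
  have hlt : ∀ t : ℤ, t < L → s * t < s * L := fun t ht => by nlinarith
  have e1 : c (u + 2 * s) = c (u + s) ∨ (L : ℤ) ≤ 2 := by
    by_contra! hcon
    have := hlt 2 hcon.2
    exact hcon.1 ((h.endpoint (x := u) (y := u + s) (u + 2 * s)
      (hint _ (by omega) (by omega)).symm (by ring) (by omega)).resolve_left
      (hint _ (by omega) (by omega)))
  have hL7 : 7 ≤ L := by
    by_contra! hcon
    have : L = 1 ∨ L = 3 ∨ L = 5 := by
      obtain ⟨m, hm⟩ := hL; omega
    rcases this with rfl | rfl | rfl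
    · apply hne'
      rw [show u + s = v by rw [hvs]; push_cast; ring,
        show v - s = u by rw [hvs]; push_cast; ring, huv']
    · apply hne'
      rw [← e1.resolve_right (by norm_num)]
      congr 1; rw [hvs]; push_cast; ring
    · apply hne'
      have hv5 : v = u + 5 * s := by rw [hvs]; push_cast; ring
      rw [← e1.resolve_right (by norm_num)]
      have := (h.endpoint (x := u) (y := u + 2 * s) (u + 4 * s)
        (hint _ (by omega) (by omega)).symm (by ring) (by omega)).resolve_left
        (hint _ (by omega) (by omega))
      rw [← this]; congr 1; omega
  have hL7' : (7 : ℤ) ≤ L := by exact_mod_cast hL7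
  have hLZ : Odd (L : ℤ) := by exact_mod_cast hL
  refine ⟨s, by nlinarith, ?_, ?_⟩
  · by_contra! hcon
    refine not_extendable_odd_gap (f := fun t => c (v + (-s) * t)) hLZ (by omega)
      (h.comp_affine v (-s) fun t ht ht' => ⟨by nlinarith, by nlinarith⟩) ?_ ?_ ?_
    · simp only [mul_zero, add_zero, huv']; congr 1; rw [hvs]; ring
    · intro t ht ht'
      have := hlt t ht'
      have := hpos t ht
      simp only [mul_zero, add_zero, huv', neg_mul]
      exact hint _ (by omega) (by omega)
    · simp only [mul_one]
      rw [show v + -s * (L - 1) = u + s by rw [hvs]; ring, ← sub_eq_add_neg]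
      exact hne'.symm
  · by_contra! hcon
    refine not_extendable_odd_gap (f := fun t => c (u + s * t)) hLZ (by omega)
      (h.comp_affine u s fun t ht ht' => ⟨by nlinarith, by nlinarith⟩) ?_ ?_ ?_
    · simp only [mul_zero, add_zero, ← hvs, huv']
    · intro t ht ht'
      have := hlt t ht'
      have := hpos t ht
      simp only [mul_zero, add_zero]
      exact hint _ (by omega) (by omega)
    · simp only [mul_one]
      rw [show u + s * (L - 1) = v - s by rw [hvs]; ring]
      exact hne'


/-- In a rainbow-free colouring of `[1, 3n]` where a colour is used `n` times, a gap between
consecutive elements of that colour has equally coloured ends. -/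
lemma gap_ends_eq {n : ℕ} (h : RainbowFree c 1 (3 * n)) {u v : ℤ}
    (hcard : ((Finset.Icc (1 : ℤ) (3 * n)).filter (fun i => c i = c u)).card = n)
    (hu : 1 ≤ u) (huv : u < v) (hv : v ≤ 3 * n) (huv' : c v = c u)
    (hint : ∀ x, u < x → x < v → c x ≠ c u) : c (u + 1) = c (v - 1) := by
  by_contra hne
  obtain ⟨s, h7, hlo, hhi⟩ := h.exists_stride_of_gap hu huv hv huv' hint hne
  have hsub : (Finset.Icc (1 : ℤ) (3 * n)).filter (fun i => c i = c u) ⊆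
      Finset.Icc 1 u ∪ Finset.Icc v (3 * n) := by
    intro x hx
    simp only [Finset.mem_filter, Finset.mem_union, Finset.mem_Icc] at hx ⊢
    by_contra! hcon
    exact hint x (by omega) (by omega) hx.2
  have h1 := (Finset.card_le_card hsub).trans (Finset.card_union_le _ _)
  rw [hcard, Int.card_Icc, Int.card_Icc] at h1
  omega

/-- Every two adjacent elements of `[lo, hi]` of different colours involve the colour `ρ`. -/
def Dominates (c : ℤ → Fin 3) (lo hi : ℤ) (ρ : Fin 3) : Prop :=
  ∀ x, lo ≤ x → x < hi → c x ≠ ρ → c (x + 1) ≠ ρ → c x = c (x + 1)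

lemma exists_ne_ne : ∀ a b : Fin 3, ∃ r, r ≠ a ∧ r ≠ b := by decide

lemma exists_dominates (hgap : ∀ u v, lo ≤ u → u < v → v ≤ hi → c v = c u →
      (∀ x, u < x → x < v → c x ≠ c u) → c (u + 1) = c (v - 1)) :
    ∀ m : ℕ, lo + m ≤ hi → ∃ ρ, Dominates c lo (lo + m) ρ := by
  intro m
  induction m with
  | zero => exact fun _ => ⟨0, fun x hx hx' => by push_cast at hx'; omega⟩
  | succ m ih =>
    intro hm
    push_cast at hm ⊢
    obtain ⟨ρ, hρ⟩ := ih (by omega)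
    set b := lo + (m : ℤ) with hb
    by_cases hstep : c b ≠ ρ ∧ c (b + 1) ≠ ρ ∧ c b ≠ c (b + 1)
    swap
    · refine ⟨ρ, fun x hx hx' h1 h2 => ?_⟩
      by_cases hxb : x = b
      · subst hxb
        by_contra h3
        exact hstep ⟨h1, h2, h3⟩
      · exact hρ x hx (by omega) h1 h2
    obtain ⟨h1, h2, h3⟩ := hstep
    have hnone : ∀ k : ℕ, ∀ x, x + k = b → lo ≤ x → c x ≠ c (b + 1) := by
      intro k
      induction k using Nat.strong_induction_on with
      | _ k ihk =>
        intro x hxk hx hcx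
        have hxb : x ≠ b := fun hxb => h3 ((congrArg c hxb).symm.trans hcx)
        have hg := hgap x (b + 1) hx (by omega) (by omega) hcx.symm fun y hy hy' => by
          rw [hcx]
          exact ihk (b - y).toNat (by omega) y (by omega) (by omega)
        rw [add_sub_cancel_right] at hg
        have := hρ x hx (by omega) (by rw [hcx]; exact h2) (by rw [hg]; exact h1)
        exact h3 (by rw [← hg, ← this, hcx])
    refine ⟨c b, fun x hx hx' hx1 hx2 => ?_⟩
    have hxb : x ≠ b := fun hxb => hx1 (by rw [hxb])
    have e1 := hnone (b - x).toNat x (by omega) hx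
    have e2 := hnone (b - (x + 1)).toNat (x + 1) (by omega) (by omega)
    have key : ∀ a b c d : Fin 3, a ≠ b → c ≠ a → c ≠ b → d ≠ a → d ≠ b → c = d := by decide
    exact key _ _ _ _ h3 hx1 e1 hx2 e2

/-- A set of naturals that is closed under halved differences of elements of equal parity and
contains two consecutive elements contains `1`. -/
lemma one_mem_of_consecutive {T : ℕ → Prop}
    (hhalf : ∀ d, 0 < d → T (2 * d) → T d)
    (hdiff : ∀ d e, 0 < d → 0 < e → T e → T (2 * d + e) → T d)
    {K : ℕ} (hK : 0 < K) (h1 : T K) (h2 : T (K + 1)) : T 1 := by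
  classical
  have hex : ∃ d, 0 < d ∧ T d := ⟨K, hK, h1⟩
  obtain ⟨hL, hTL⟩ := Nat.find_spec hex
  have hmin : ∀ d, 0 < d → T d → Nat.find hex ≤ d := fun d hd hT => Nat.find_min' hex ⟨hd, hT⟩
  set L := Nat.find hex
  have hLodd : Odd L := by
    by_contra hcon
    rw [Nat.not_odd_iff_even] at hcon
    obtain ⟨r, hr⟩ := hcon
    have := hmin r (by omega) (hhalf r (by omega) (by rwa [two_mul, ← hr]))
    omega
  have hdvd : ∀ d, 0 < d → T d → L ∣ d := by
    intro d
    induction d using Nat.strong_induction_on with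
    | _ d ih =>
      intro hd hT
      rcases Nat.even_or_odd' d with ⟨r, hr | hr⟩
      · have := ih r (by omega) (by omega) (hhalf r (by omega) (hr ▸ hT))
        rw [hr]
        exact this.mul_left 2
      · obtain ⟨q, hq⟩ := hLodd
        have hle := hmin d hd hT
        by_cases hdL : d = L
        · rw [hdL]
        · have hsum : d = 2 * (r - q) + L := by omega
          have := ih (r - q) (by omega) (by omega)
            (hdiff (r - q) L (by omega) hL hTL (hsum ▸ hT))
          rw [hsum]
          exact Dvd.dvd.add (this.mul_left 2) dvd_rfl
  have : L ∣ 1 := (Nat.dvd_add_right (hdvd K hK h1)).1 (hdvd (K + 1) (by omega) h2)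
  rwa [Nat.dvd_one.1 this] at hTL

/-- If a colour only occurs left of the origin (inclusive), another one only to its right, and
the latter occupies both `K` and `K + 1`, then it is adjacent to the origin. -/
lemma adjacent_of_separated {f : ℤ → Fin 3} {K : ℕ} {γ : Fin 3}
    (h : RainbowFree f (-((K : ℤ) + 1)) (K + 1)) (hγ : f 0 ≠ γ)
    (hright : ∀ t : ℤ, 0 < t → t ≤ K + 1 → f t ≠ f 0)
    (hleft : ∀ t : ℤ, t < 0 → -((K : ℤ) + 1) ≤ t → f t ≠ γ)
    (h1 : f K = γ) (h2 : f (K + 1) = γ) : f 1 = γ := by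
  rcases Nat.eq_zero_or_pos K with rfl | hK
  · simpa using h2
  have refl : ∀ e : ℤ, 0 < e → e ≤ K + 1 → f e = γ → f (-e) = f 0 := fun e he he' hfe =>
    ((h.endpoint (x := e) (y := 0) (-e) (by rw [hfe]; exact hγ.symm)
        (by ring) (by omega)).resolve_left
      (by rw [hfe]; exact hleft _ (by omega) (by omega)))
  have key := one_mem_of_consecutive (T := fun d => (d : ℤ) ≤ K + 1 ∧ f d = γ)
    (fun d hd ⟨hd1, hd2⟩ => by
      push_cast at hd1 hd2
      refine ⟨by omega, ?_⟩
      have := (h.mid (x := 0) (z := 2 * d) d (by rw [hd2]; exact hγ)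
          (by ring) (by omega)).resolve_left
        (hright _ (by omega) (by omega))
      rw [this, hd2])
    (fun d e hd he ⟨he1, he2⟩ ⟨hd1, hd2⟩ => by
      push_cast at hd1 hd2
      refine ⟨by omega, ?_⟩
      have hr := refl e (by omega) he1 he2
      have := (h.mid (x := -e) (z := 2 * d + e) d (by rw [hd2, hr]; exact hγ)
        (by ring) (by omega)).resolve_left (by rw [hr]; exact hright _ (by omega) (by omega))
      rw [this, hd2])
    hK ⟨by omega, h1⟩ ⟨by push_cast; omega, by push_cast; exact h2⟩
  simpa using key.2

/-- Adjacent equally coloured pairs all have the same colour, apart from the dominating one. -/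
lemma pairs_eq (h : RainbowFree c lo hi) {ρ : Fin 3} (hρ : Dominates c lo hi ρ) :
    ∀ k : ℕ, ∀ p q : ℤ, q = p + k → lo ≤ p → p < q → q < hi → c p = c (p + 1) → c p ≠ ρ →
      c q = c (q + 1) → c q ≠ ρ → c p = c q := by
  intro k
  induction k using Nat.strong_induction_on with
  | _ k ih =>
    intro p q hpq hlo hlt hhi hp hpρ hq hqρ
    by_contra hne
    have hno : ∀ x : ℤ, p < x → x < q → c x ≠ ρ → c (x + 1) ≠ ρ → False := by
      intro x hx hx' h1 h2
      have hxx := hρ x (by omega) (by omega) h1 h2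
      have e1 := ih (x - p).toNat (by omega) p x (by omega) hlo hx (by omega) hp hpρ hxx h1
      have e2 := ih (q - x).toNat (by omega) x q (by omega) (by omega) hx' hhi hxx h1 hq hqρ
      exact hne (e1.trans e2)
    have hp1 : c (p + 1) ≠ ρ := hp ▸ hpρ
    have hq1 : c (q + 1) ≠ ρ := hq ▸ hqρ
    have hpq1 : p + 1 ≠ q := fun hcon => hne (by rw [hp, hcon])
    have nonρ : ∀ {a b w}, (c w = c a ∨ c w = c b) → c a ≠ ρ → c b ≠ ρ → c w ≠ ρ := by
      rintro a b w (hw | hw) ha hb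
      · rwa [hw]
      · rwa [hw]
    rcases Int.even_or_odd' (q - p) with ⟨r, hr | hr⟩
    · refine hno (p + r) (by omega) (by omega) ?_ ?_
      · exact nonρ (h.mid (x := p) (z := q) (p + r) hne (by omega) (by omega)) hpρ hqρ
      · exact nonρ (h.mid (x := p + 1) (z := q + 1) (p + r + 1) (by rwa [← hp, ← hq])
            (by omega) (by omega))
          hp1 hq1
    set M := p + r + 1 with hM
    have hMor : c M = c p ∨ c M = c (q + 1) :=
      h.mid (x := p) (z := q + 1) M (by rwa [← hq]) (by omega) (by omega)
    have noγ : ∀ g : ℤ, p < g → g < M → c g ≠ c q := by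
      intro g hg hgM hcg
      have hg1 : g ≠ p + 1 := fun hcon => hne (by rw [hp, ← hcon, hcg])
      refine hno (2 * g - p - 1) (by omega) (by omega) ?_ ?_
      · exact nonρ (h.endpoint (x := p + 1) (y := g) _ (by rwa [hcg, ← hp]) (by ring) (by omega))
          hp1 (hcg ▸ hqρ)
      · exact nonρ (h.endpoint (x := p) (y := g) _ (by rwa [hcg]) (by ring) (by omega))
          hpρ (hcg ▸ hqρ)
    have noβ : ∀ b : ℤ, M < b → b < q + 1 → c b ≠ c p := by
      intro b hb hbq hcb
      have hb1 : b ≠ q := fun hcon => hne (by rw [← hcon, hcb])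
      refine hno (2 * b - q - 1) (by omega) (by omega) ?_ ?_
      · exact nonρ (h.endpoint (x := q + 1) (y := b) _ (by rw [hcb, ← hq]; exact Ne.symm hne)
          (by ring) (by omega)) hq1 (hcb ▸ hpρ)
      · exact nonρ (h.endpoint (x := q) (y := b) _ (by rw [hcb]; exact Ne.symm hne)
            (by ring) (by omega))
          hqρ (hcb ▸ hpρ)
    rcases hMor with hMc | hMc
    · have hadj := adjacent_of_separated (f := fun t => c (M + 1 * t)) (K := r.toNat)
        (γ := c q) (h.comp_affine M 1 fun t ht ht' => ⟨by omega, by omega⟩)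
        (by simpa [hMc] using hne)
        (fun t ht ht' => by
          simp only [mul_zero, add_zero, one_mul, hMc]
          by_cases hend : M + t = q + 1
          · rw [hend, ← hq]; exact Ne.symm hne
          · exact noβ _ (by omega) (by omega))
        (fun t ht ht' => by
          simp only [one_mul]
          by_cases hend : M + t = p
          · rw [hend]; exact hne
          · exact noγ _ (by omega) (by omega))
        (by show c _ = c q; congr 1; omega)
        (by show c _ = c q; rw [hq]; congr 1; omega)
      simp only [one_mul] at hadj
      have := hρ M (by omega) (by omega) (by rwa [hMc]) (by rwa [hadj])
      exact hne (by rw [← hMc, this, hadj])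
    · rw [← hq] at hMc
      have hadj := adjacent_of_separated (f := fun t => c (M + (-1) * t)) (K := r.toNat)
        (γ := c p) (h.comp_affine M (-1) fun t ht ht' => ⟨by omega, by omega⟩)
        (by simpa [hMc] using Ne.symm hne)
        (fun t ht ht' => by
          simp only [mul_zero, add_zero, hMc]
          by_cases hend : M + (-1) * t = p
          · rw [hend]; exact hne
          · exact noγ _ (by omega) (by omega))
        (fun t ht ht' => by
          by_cases hend : M + (-1) * t = q + 1
          · rw [hend, ← hq]; exact Ne.symm hne
          · exact noβ _ (by omega) (by omega))
        (by show c _ = c p; rw [hp]; congr 1; omega)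
        (by show c _ = c p; congr 1; omega)
      simp only [mul_one] at hadj
      have := hρ (M + -1) (by omega) (by omega) (by rwa [hadj])
        (by rw [neg_add_cancel_right, hMc]; exact hqρ)
      rw [neg_add_cancel_right] at this
      exact hne (by rw [← hadj, this, hMc])

/-- If no two adjacent elements have the colour `γ` and some other non-dominating colour occurs
before `γ`, then `γ` is used less often than the dominating colour. -/
lemma card_lt_of_isolated (h : RainbowFree c lo hi) {ρ γ : Fin 3} (hρ : Dominates c lo hi ρ)
    (hγρ : γ ≠ ρ) (hiso : ∀ x, lo ≤ x → x < hi → c x = γ → c (x + 1) ≠ γ)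
    {b g : ℤ} (hb : lo ≤ b) (hbg : b < g) (hg : g ≤ hi) (hbγ : c b ≠ γ) (hbρ : c b ≠ ρ)
    (hgγ : c g = γ) :
    ((Finset.Icc lo hi).filter (fun i => c i = γ)).card <
      ((Finset.Icc lo hi).filter (fun i => c i = ρ)).card := by
  obtain ⟨b', ⟨hb1, hb2, hb3⟩, hmax⟩ := Int.exists_greatest_of_bdd
    (P := fun x => lo ≤ x ∧ x < g ∧ c x = c b) ⟨g, fun z hz => hz.2.1.le⟩ ⟨b, hb, hbg, rfl⟩
  have hmax' : ∀ x, b' < x → x < g → c x ≠ c b := fun x hx hxg hcx => by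
    have := hmax x ⟨by omega, hxg, hcx⟩
    omega
  have hρ1 : c (b' + 1) = ρ := by
    by_contra hcon
    have := hρ b' hb1 (by omega) (by rwa [hb3]) hcon
    rw [hb3] at this
    by_cases hend : b' + 1 = g
    · exact hbγ (by rw [this, hend, hgγ])
    · exact hmax' (b' + 1) (by omega) (by omega) this.symm
  have hg1 : b' + 1 ≠ g := fun hcon => hγρ (by rw [← hgγ, ← hcon, hρ1])
  have hρ2 : c (b' + 2) = ρ := by
    rcases h.endpoint (x := b') (y := b' + 1) (b' + 2) (by rwa [hb3, hρ1])
        (by ring) (by omega) with h2 | h2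
    · by_cases hend : b' + 2 = g
      · exact absurd (by rw [← hb3, ← h2, hend, hgγ]) hbγ
      · exact absurd (by rw [h2, hb3]) (hmax' (b' + 2) (by omega) (by omega))
    · rw [h2, hρ1]
  classical
  set G := (Finset.Icc lo hi).filter (fun i => c i = γ) with hG
  set R := (Finset.Icc lo hi).filter (fun i => c i = ρ) with hR
  have hsub : insert (b' + 1) (insert (b' + 2) ((G.erase hi).image (· + 1))) ⊆ R := by
    intro x hx
    simp only [Finset.mem_insert, Finset.mem_image, Finset.mem_erase, hG, hR, Finset.mem_filter,
      Finset.mem_Icc] at hx ⊢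
    rcases hx with rfl | rfl | ⟨y, ⟨hy, ⟨hy1, hy2⟩, hy3⟩, rfl⟩
    · exact ⟨⟨by omega, by omega⟩, hρ1⟩
    · exact ⟨⟨by omega, by omega⟩, hρ2⟩
    · refine ⟨⟨by omega, by omega⟩, ?_⟩
      by_contra hcon
      exact hiso y hy1 (by omega) hy3
        ((hρ y hy1 (by omega) (by rwa [hy3]) hcon).symm.trans hy3)
  have hn2 : b' + 2 ∉ (G.erase hi).image (· + 1) := by
    simp only [Finset.mem_image, Finset.mem_erase, hG, Finset.mem_filter, not_exists, not_and]
    rintro y ⟨-, -, hy⟩ hy'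
    rw [show y = b' + 1 by omega, hρ1] at hy
    exact hγρ hy.symm
  have hn1 : b' + 1 ∉ insert (b' + 2) ((G.erase hi).image (· + 1)) := by
    simp only [Finset.mem_insert, Finset.mem_image, Finset.mem_erase, hG, Finset.mem_filter,
      not_or, not_exists, not_and]
    refine ⟨by omega, ?_⟩
    rintro y ⟨-, -, hy⟩ hy'
    rw [show y = b' by omega, hb3] at hy
    exact hbγ hy
  have hcard := Finset.card_le_card hsub
  rw [Finset.card_insert_of_notMem hn1, Finset.card_insert_of_notMem hn2,
    Finset.card_image_of_injective _ (add_left_injective 1)] at hcard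
  have := Finset.pred_card_le_card_erase (s := G) (a := hi)
  omega

lemma card_filter_neg (c : ℤ → Fin 3) (lo hi : ℤ) (x : Fin 3) :
    ((Finset.Icc (-hi) (-lo)).filter (fun i => c (-i) = x)).card =
      ((Finset.Icc lo hi).filter (fun i => c i = x)).card := by
  refine Finset.card_nbij' (fun i => -i) (fun i => -i) ?_ ?_ ?_ ?_ <;> intro i <;>
    simp only [Finset.coe_filter, Set.mem_ofPred_eq, Finset.mem_Icc, neg_neg, implies_true] <;>
    exact fun hi => ⟨⟨by omega, by omega⟩, hi.2⟩

lemma not_equinumerous {n : ℕ} (hn : 0 < n) (h : RainbowFree c 1 (3 * n)) :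
    ¬ ∀ x, ((Finset.Icc (1 : ℤ) (3 * n)).filter (fun i => c i = x)).card = n := by
  intro hcard
  obtain ⟨ρ, hρ⟩ := exists_dominates (c := c) (lo := 1) (hi := 3 * n)
    (fun u v hu huv hv huv' hint => h.gap_ends_eq (hcard _) hu huv hv huv' hint)
    (3 * n - 1) (by omega)
  rw [show (1 : ℤ) + ((3 * n - 1 : ℕ) : ℤ) = 3 * n by omega] at hρ
  have hocc : ∀ x, ∃ i, 1 ≤ i ∧ i ≤ 3 * (n : ℤ) ∧ c i = x := by
    intro x
    obtain ⟨i, hi⟩ := Finset.card_pos.1 (by rw [hcard x]; exact hn)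
    simp only [Finset.mem_filter, Finset.mem_Icc] at hi
    exact ⟨i, hi.1.1, hi.1.2, hi.2⟩
  have hiso : ∃ γ, γ ≠ ρ ∧ ∀ x, 1 ≤ x → x < 3 * (n : ℤ) → c x = γ → c (x + 1) ≠ γ := by
    by_contra! hcon
    obtain ⟨β, hβ, -⟩ := exists_ne_ne ρ ρ
    obtain ⟨γ, hγ, hγβ⟩ := exists_ne_ne ρ β
    obtain ⟨p, hp, hp', hp1, hp2⟩ := hcon β hβ
    obtain ⟨q, hq, hq', hq1, hq2⟩ := hcon γ hγ
    rcases lt_trichotomy p q with hlt | heq | hlt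
    · have := h.pairs_eq hρ (q - p).toNat p q (by omega) hp hlt hq' (by rw [hp1, hp2])
        (by rwa [hp1]) (by rw [hq1, hq2]) (by rwa [hq1])
      exact hγβ (by rw [← hq1, ← this, hp1])
    · exact hγβ (by rw [← hq1, ← heq, hp1])
    · have := h.pairs_eq hρ (p - q).toNat q p (by omega) hq hlt hp' (by rw [hq1, hq2])
        (by rwa [hq1]) (by rw [hp1, hp2]) (by rwa [hp1])
      exact hγβ (by rw [← hq1, this, hp1])
  obtain ⟨γ, hγρ, hiso⟩ := hiso
  obtain ⟨β, hβρ, hβγ⟩ := exists_ne_ne ρ γ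
  obtain ⟨b, hb, hb', rfl⟩ := hocc β
  obtain ⟨g, hg, hg', hgγ⟩ := hocc γ
  rcases lt_trichotomy b g with hlt | heq | hlt
  · have := h.card_lt_of_isolated hρ hγρ hiso hb hlt hg' hβγ hβρ hgγ
    rw [hcard, hcard] at this
    exact lt_irrefl _ this
  · exact hβγ (by rw [heq, hgγ])
  · have h' : RainbowFree (fun t => c (-t)) (-(3 * n)) (-1) := by
      simpa using h.comp_affine (lo' := -(3 * n)) (hi' := -1) 0 (-1)
        fun t ht ht' => ⟨by omega, by omega⟩
    have hρ' : Dominates (fun t => c (-t)) (-(3 * n)) (-1) ρ := fun x hx hx' h1 h2 => by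
      have := hρ (-(x + 1)) (by omega) (by omega) h2 (by simpa using h1)
      simpa using this.symm
    have := h'.card_lt_of_isolated hρ' hγρ
      (fun x hx hx' h1 h2 => hiso (-(x + 1)) (by omega) (by omega) h2 (by simpa using h1))
      (b := -b) (g := -g) (by omega) (by omega) (by omega) (by simpa using hβγ)
      (by simpa using hβρ) (by simpa using hgγ)
    rw [card_filter_neg, card_filter_neg, hcard, hcard] at this
    exact lt_irrefl _ this

end RainbowFree

/-- To refute the rainbow property it suffices to give colours as natural numbers on `0, 1, …`,
together with an injective list of `n` elements of each colour. -/
lemma exists_equinumerous_not_rainbow {k n : ℕ} [NeZero k] (f : ℕ → ℕ) (g : ℕ → ℕ → ℕ)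
    (hg : ∀ i < k, ∀ j < n, g i j < k * n ∧ f (g i j) = i)
    (hinj : ∀ i < k, ∀ j < n, ∀ j' < n, g i j = g i j' → j = j')
    (hap : ∀ a d, 1 ≤ d → a + (k - 1) * d < k * n →
      ∃ i < k, ∃ j < k, i ≠ j ∧ f (a + i * d) = f (a + j * d)) :
    ∃ c : ℕ → Fin k, (∀ x : Fin k, ((Finset.Icc 1 (k * n)).filter (fun i => c i = x)).card = n) ∧
      ¬ RainbowAPk k (k * n) c := by
  refine ⟨fun x => Fin.ofNat k (f (x - 1)), ?_, ?_⟩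
  · set c : ℕ → Fin k := fun x => Fin.ofNat k (f (x - 1))
    have hle : ∀ x : Fin k, n ≤ ((Finset.Icc 1 (k * n)).filter (fun i => c i = x)).card := by
      intro x
      have hmaps : ∀ j ∈ Finset.range n,
          g x j + 1 ∈ (Finset.Icc 1 (k * n)).filter (fun i => c i = x) := by
        intro j hj
        obtain ⟨h1, h2⟩ := hg x x.2 j (Finset.mem_range.1 hj)
        simp only [Finset.mem_filter, Finset.mem_Icc]
        refine ⟨⟨by omega, by omega⟩, ?_⟩
        simp [c, h2]
      have := Finset.card_le_card_of_injOn (fun j => g x j + 1) hmaps fun j hj j' hj' hjj => by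
        simp only [Finset.coe_range, Set.mem_Iio] at hj hj'
        exact hinj x x.2 j hj j' hj' (by simpa using hjj)
      simpa using this
    have hsum : ∑ x : Fin k, n =
        ∑ x : Fin k, ((Finset.Icc 1 (k * n)).filter (fun i => c i = x)).card := by
      rw [← Finset.card_eq_sum_card_fiberwise (fun _ _ => by simp)]
      simp
    exact fun x =>
      ((Finset.sum_eq_sum_iff_of_le fun x _ => hle x).1 hsum x (Finset.mem_univ x)).symm
  · rintro ⟨a, d, ha, hd, hlast, hrainbow⟩
    obtain ⟨i, hi, j, hj, hij, heq⟩ := hap (a - 1) d hd (by omega)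
    refine hrainbow ⟨i, hi⟩ ⟨j, hj⟩ (by simpa using hij) ?_
    show Fin.ofNat k (f (a + i * d - 1)) = Fin.ofNat k (f (a + j * d - 1))
    rw [show a + i * d - 1 = a - 1 + i * d by omega, heq,
      show a + j * d - 1 = a - 1 + j * d by omega]

/-- A four-colouring of `[0, 4n)` without rainbow progressions. -/
def fourColor (n x : ℕ) : ℕ :=
  if x % 2 = 0 then
    if n % 2 = 1 ∧ x = 4 * n - 2 * (n / 2) - 2 then 3
    else if n % 2 = 1 ∧ x = 4 * n - 2 * (n / 2) then 2
    else if x < 2 * (n - n / 2) then 0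
    else if x < 4 * n - 2 * (n / 2) then 2
    else 3
  else if x % 4 = 1 then if x < 4 * (n / 2) then 0 else 1
  else if x < 4 * (n / 2) then 1 else 3

/-- The `j`-th element of colour `i` in `fourColor n`. -/
def fourColorElem (n i j : ℕ) : ℕ :=
  match i with
  | 0 => if j < n - n / 2 then 2 * j else 4 * (j - (n - n / 2)) + 1
  | 1 => if j < n / 2 then 4 * j + 3 else 4 * j + 1
  | 2 => if n % 2 = 1 ∧ j = n - 1 then 4 * n - 2 * (n / 2) else 2 * (n - n / 2 + j)
  | _ => if j < n / 2 then
      if n % 2 = 1 ∧ j = 0 then 4 * n - 2 * (n / 2) - 2 else 2 * (2 * n - n / 2 + j)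
    else 4 * j + 3

lemma fourColor_even {n x : ℕ} (hn : 1 < n) (hx : x % 2 = 0) :
    (fourColor n x = 0 ∧ x < 2 * (n - n / 2)) ∨
    (fourColor n x = 2 ∧ 2 * (n - n / 2) ≤ x ∧ x ≤ 4 * n - 2 * (n / 2) - 2 + 2 * (n % 2) ∧
      (n % 2 = 1 → x ≠ 4 * n - 2 * (n / 2) - 2)) ∨
    (fourColor n x = 3 ∧ 4 * n - 2 * (n / 2) ≤ x + 2 * (n % 2) ∧
      (n % 2 = 1 → x ≠ 4 * n - 2 * (n / 2))) := by
  unfold fourColor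
  split_ifs <;> omega

lemma fourColor_one {n x : ℕ} (hx : x % 4 = 1) :
    (fourColor n x = 0 ∧ x < 4 * (n / 2)) ∨ (fourColor n x = 1 ∧ 4 * (n / 2) ≤ x) := by
  unfold fourColor
  split_ifs <;> omega

lemma fourColor_three {n x : ℕ} (hx : x % 4 = 3) :
    (fourColor n x = 1 ∧ x < 4 * (n / 2)) ∨ (fourColor n x = 3 ∧ 4 * (n / 2) ≤ x) := by
  unfold fourColor
  split_ifs <;> omega

set_option maxHeartbeats 1000000 in
lemma fourColor_not_rainbow {n a d : ℕ} (hn : 1 < n) (h : a + 3 * d < 4 * n) :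
    fourColor n a = fourColor n (a + d) ∨ fourColor n a = fourColor n (a + 2 * d) ∨
    fourColor n a = fourColor n (a + 3 * d) ∨ fourColor n (a + d) = fourColor n (a + 2 * d) ∨
    fourColor n (a + d) = fourColor n (a + 3 * d) ∨
    fourColor n (a + 2 * d) = fourColor n (a + 3 * d) := by
  by_contra! hne
  obtain ⟨h01, h02, h03, h12, h13, h23⟩ := hne
  have ha : a % 4 = 0 ∨ a % 4 = 1 ∨ a % 4 = 2 ∨ a % 4 = 3 := by omega
  have hd4 : d % 4 = 0 ∨ d % 4 = 1 ∨ d % 4 = 2 ∨ d % 4 = 3 := by omega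
  rcases ha with ha | ha | ha | ha <;> rcases hd4 with hd4 | hd4 | hd4 | hd4
  all_goals
    first
    | have e0 := fourColor_even (n := n) (x := a) hn (by omega)
    | have e0 := fourColor_one (n := n) (x := a) (by omega)
    | have e0 := fourColor_three (n := n) (x := a) (by omega)
  all_goals
    first
    | have e1 := fourColor_even (n := n) (x := a + d) hn (by omega)
    | have e1 := fourColor_one (n := n) (x := a + d) (by omega)
    | have e1 := fourColor_three (n := n) (x := a + d) (by omega)
  all_goals
    first
    | have e2 := fourColor_even (n := n) (x := a + 2 * d) hn (by omega)
    | have e2 := fourColor_one (n := n) (x := a + 2 * d) (by omega)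
    | have e2 := fourColor_three (n := n) (x := a + 2 * d) (by omega)
  all_goals
    first
    | have e3 := fourColor_even (n := n) (x := a + 3 * d) hn (by omega)
    | have e3 := fourColor_one (n := n) (x := a + 3 * d) (by omega)
    | have e3 := fourColor_three (n := n) (x := a + 3 * d) (by omega)
  all_goals
    (first | obtain ⟨e0, f0⟩ | ⟨e0, f0⟩ | ⟨e0, f0⟩ := e0 | obtain ⟨e0, f0⟩ | ⟨e0, f0⟩ := e0) <;>
      (first | obtain ⟨e1, f1⟩ | ⟨e1, f1⟩ | ⟨e1, f1⟩ := e1 | obtain ⟨e1, f1⟩ | ⟨e1, f1⟩ := e1) <;>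
      first
      | exact h01 (e0.trans e1.symm)
      | (first | obtain ⟨e2, f2⟩ | ⟨e2, f2⟩ | ⟨e2, f2⟩ := e2 | obtain ⟨e2, f2⟩ | ⟨e2, f2⟩ := e2) <;>
        first
        | exact h02 (e0.trans e2.symm)
        | exact h12 (e1.trans e2.symm)
        | (first | obtain ⟨e3, f3⟩ | ⟨e3, f3⟩ | ⟨e3, f3⟩ := e3 | obtain ⟨e3, f3⟩ | ⟨e3, f3⟩ := e3) <;>
          first
          | exact h03 (e0.trans e3.symm)
          | exact h13 (e1.trans e3.symm)
          | exact h23 (e2.trans e3.symm)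
          | clear h01 h02 h03 h12 h13 h23; omega

theorem exists_four_coloring {n : ℕ} (hn : 1 < n) :
    ∃ c : ℕ → Fin 4, (∀ x : Fin 4, ((Finset.Icc 1 (4 * n)).filter (fun i => c i = x)).card = n) ∧
      ¬ RainbowAPk 4 (4 * n) c := by
  refine exists_equinumerous_not_rainbow (fourColor n) (fourColorElem n) ?_ ?_ ?_
  · intro i hi j hj
    interval_cases i <;> simp only [fourColorElem] <;> unfold fourColor <;> split_ifs <;> omega
  · intro i hi j hj j' hj'
    interval_cases i <;> simp only [fourColorElem] <;> split_ifs <;> omega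
  · intro a d _ h
    rcases fourColor_not_rainbow hn (by omega) with h | h | h | h | h | h
    · exact ⟨0, by omega, 1, by omega, by omega, by simpa using h⟩
    · exact ⟨0, by omega, 2, by omega, by omega, by simpa using h⟩
    · exact ⟨0, by omega, 3, by omega, by omega, by simpa using h⟩
    · exact ⟨1, by omega, 2, by omega, by omega, by simpa using h⟩
    · exact ⟨1, by omega, 3, by omega, by omega, by simpa using h⟩
    · exact ⟨2, by omega, 3, by omega, by omega, by simpa using h⟩

/-- A colouring of `[0, kn)` without rainbow `k`-term progressions, for every `k ≥ 5`. -/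
def manyColor (n x : ℕ) : ℕ :=
  if x = 0 then 1
  else if x ≤ n then 0
  else if x ≤ n + n / 2 then 2
  else if x < 2 * n then 1
  else if x < 3 * n - n / 2 then 2
  else if x < 3 * n then 3
  else if x < 3 * n + n / 2 then 1
  else if x < 4 * n then 3
  else x / n

/-- The `j`-th element of colour `i` in `manyColor n`. -/
def manyColorElem (n i j : ℕ) : ℕ :=
  match i with
  | 0 => j + 1
  | 1 => if j = 0 then 0 else if j < n - n / 2 then n + n / 2 + j else 3 * n + (j - (n - n / 2))
  | 2 => if j < n / 2 then n + 1 + j else 2 * n + (j - n / 2)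
  | 3 => if j < n / 2 then 3 * n - n / 2 + j else 3 * n + j
  | i => i * n + j

lemma manyColor_of_le {n x : ℕ} (hn : 1 < n) (hx : 4 * n ≤ x) : manyColor n x = x / n := by
  unfold manyColor
  split_ifs <;> omega

lemma manyColor_of_lt {n x : ℕ} (hx : x < 4 * n) : manyColor n x < 4 := by
  unfold manyColor
  split_ifs <;> omega

lemma manyColor_eq_zero {n x : ℕ} (hx : 1 ≤ x ∧ x ≤ n) : manyColor n x = 0 := by
  unfold manyColor
  split_ifs <;> omega

lemma manyColor_eq_one {n x : ℕ} (hn : 1 < n) (hx : x = 0 ∨ n + n / 2 < x ∧ x < 2 * n ∨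
    3 * n ≤ x ∧ x < 3 * n + n / 2) : manyColor n x = 1 := by
  unfold manyColor
  split_ifs <;> omega

lemma manyColor_eq_two {n x : ℕ} (hx : n < x ∧ x ≤ n + n / 2 ∨
    2 * n ≤ x ∧ x < 3 * n - n / 2) : manyColor n x = 2 := by
  unfold manyColor
  split_ifs <;> omega

lemma manyColor_eq_three {n x : ℕ} (hx : 3 * n - n / 2 ≤ x ∧ x < 3 * n ∨
    3 * n + n / 2 ≤ x ∧ x < 4 * n) : manyColor n x = 3 := by
  unfold manyColor
  split_ifs <;> omega

lemma le_of_manyColor_eq_zero {n x : ℕ} (hn : 1 < n) (hx : manyColor n x = 0) :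
    1 ≤ x ∧ x ≤ n := by
  by_cases h : 4 * n ≤ x
  · rw [manyColor_of_le hn h] at hx
    rcases Nat.div_eq_zero_iff.1 hx with hx | hx <;> omega
  · unfold manyColor at hx
    split_ifs at hx <;> omega

lemma manyColor_middle {n x y z : ℕ} (hx : n < x) (hx' : x < 2 * n) (hy : 2 * n ≤ y)
    (hy' : y < 3 * n) (hz : 3 * n ≤ z) (hz' : z < 4 * n) (h : x + z = 2 * y) :
    manyColor n x = manyColor n y ∨ manyColor n y = manyColor n z ∨
      manyColor n x = manyColor n z := by
  rcases le_or_gt x (n + n / 2) with hx2 | hx2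
  · rw [manyColor_eq_two (x := x) (by omega)]
    rcases lt_or_ge y (3 * n - n / 2) with hy2 | hy2
    · rw [manyColor_eq_two (x := y) (by omega)]
      exact Or.inl rfl
    · rw [manyColor_eq_three (x := y) (by omega), manyColor_eq_three (x := z) (by omega)]
      exact Or.inr (Or.inl rfl)
  · rw [manyColor_eq_one (x := x) (by omega) (by omega)]
    rcases lt_or_ge z (3 * n + n / 2) with hz2 | hz2
    · rw [manyColor_eq_one (x := z) (by omega) (by omega)]
      exact Or.inr (Or.inr rfl)
    · rw [manyColor_eq_three (x := y) (by omega), manyColor_eq_three (x := z) (by omega)]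
      exact Or.inr (Or.inl rfl)

theorem manyColor_not_rainbow {k n a d : ℕ} (hk : 5 ≤ k) (hn : 1 < n) (hd : 1 ≤ d)
    (h : a + (k - 1) * d < k * n) :
    ∃ i < k, ∃ j < k, i ≠ j ∧ manyColor n (a + i * d) = manyColor n (a + j * d) := by
  by_contra! hne
  have hlt : ∀ i < k, a + i * d < k * n := fun i hi =>
    (Nat.add_le_add_left (Nat.mul_le_mul_right d (by omega)) a).trans_lt h
  have hcol : ∀ i < k, manyColor n (a + i * d) < k := by
    intro i hi
    by_cases hx : 4 * n ≤ a + i * d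
    · rw [manyColor_of_le hn hx]
      exact Nat.div_lt_of_lt_mul ((hlt i hi).trans_eq (mul_comm k n))
    · exact (manyColor_of_lt (by omega)).trans (by omega)
  have hinj : Function.Injective
      (fun i : Fin k => (⟨manyColor n (a + i * d), hcol i i.2⟩ : Fin k)) := by
    intro i j hij
    by_contra hij'
    exact hne i i.2 j j.2 (fun h => hij' (Fin.ext h)) (congrArg Fin.val hij)
  have hsurj : ∀ v < k, ∃ i < k, manyColor n (a + i * d) = v := by
    intro v hv
    obtain ⟨i, hi⟩ := Finite.injective_iff_surjective.1 hinj ⟨v, hv⟩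
    exact ⟨i, i.2, congrArg Fin.val hi⟩
  obtain ⟨i₀, hi₀, h0⟩ := hsurj 0 (by omega)
  obtain ⟨i₁, hi₁, h1⟩ := hsurj (k - 1) (by omega)
  obtain ⟨hlo0, hhi0⟩ := le_of_manyColor_eq_zero hn h0
  have hlast : (k - 1) * n ≤ a + (k - 1) * d := by
    have h4 : 4 * n ≤ a + i₁ * d := by
      by_contra hcon
      have := manyColor_of_lt (n := n) (x := a + i₁ * d) (by omega)
      omega
    rw [manyColor_of_le hn h4] at h1
    calc (k - 1) * n ≤ a + i₁ * d := by rw [← h1]; exact Nat.div_mul_le_self _ _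
      _ ≤ a + (k - 1) * d := Nat.add_le_add_left (Nat.mul_le_mul_right d (by omega)) a
  obtain ⟨s, rfl⟩ : ∃ s, k = s + 4 := ⟨k - 4, by omega⟩
  simp only [show s + 4 - 1 = s + 3 by omega, add_mul] at h hlast
  have hdn : d ≤ n → s * d ≤ s * n := Nat.mul_le_mul_left s
  have hnd : n ≤ d → s * n ≤ s * d := Nat.mul_le_mul_left s
  rcases Nat.eq_zero_or_pos a with rfl | ha
  · have hi : 1 ≤ i₀ := by
      by_contra hcon
      rw [show i₀ = 0 by omega] at hlo0
      omega
    have := Nat.mul_le_mul_right d hi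
    have hdn' : d = n := by omega
    subst hdn'
    refine hne 0 (by omega) 3 (by omega) (by omega) ?_
    rw [manyColor_eq_one hn (by omega), manyColor_eq_one hn (by omega)]
  · have ha0 : manyColor n a = 0 := manyColor_eq_zero (by omega)
    have hx1 : n < a + d := by
      by_contra hcon
      refine hne 0 (by omega) 1 (by omega) (by omega) ?_
      rw [zero_mul, add_zero, ha0, one_mul, manyColor_eq_zero (by omega)]
    rcases manyColor_middle (n := n) (x := a + 1 * d) (y := a + 2 * d) (z := a + 3 * d)
      (by omega) (by omega) (by omega) (by omega) (by omega) (by omega) (by omega) with h | h | h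
    · exact hne 1 (by omega) 2 (by omega) (by omega) h
    · exact hne 2 (by omega) 3 (by omega) (by omega) h
    · exact hne 1 (by omega) 3 (by omega) (by omega) h

theorem exists_many_coloring {k n : ℕ} (hk : 5 ≤ k) (hn : 1 < n) :
    ∃ c : ℕ → Fin k, (∀ x : Fin k, ((Finset.Icc 1 (k * n)).filter (fun i => c i = x)).card = n) ∧
      ¬ RainbowAPk k (k * n) c := by
  have : NeZero k := ⟨by omega⟩
  have h5 : 5 * n ≤ k * n := Nat.mul_le_mul_right n hk
  refine exists_equinumerous_not_rainbow (manyColor n) (manyColorElem n) ?_ ?_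
    fun a d => manyColor_not_rainbow hk hn
  · intro i hi j hj
    match i with
    | 0 =>
      simp only [manyColorElem]
      exact ⟨by omega, manyColor_eq_zero (by omega)⟩
    | 1 =>
      simp only [manyColorElem]
      split_ifs <;> exact ⟨by omega, manyColor_eq_one hn (by omega)⟩
    | 2 =>
      simp only [manyColorElem]
      split_ifs <;> exact ⟨by omega, manyColor_eq_two (by omega)⟩
    | 3 =>
      simp only [manyColorElem]
      split_ifs <;> exact ⟨by omega, manyColor_eq_three (by omega)⟩
    | i + 4 =>
      have h1 : (i + 4 + 1) * n ≤ k * n := Nat.mul_le_mul_right n hi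
      simp only [manyColorElem]
      refine ⟨by rw [add_mul] at h1; omega, ?_⟩
      rw [manyColor_of_le hn (by rw [add_mul]; omega), add_comm,
        Nat.add_mul_div_right _ _ (by omega), Nat.div_eq_of_lt hj, zero_add]
  · intro i hi j hj j' hj'
    match i with
    | 0 => simp [manyColorElem]
    | 1 | 2 | 3 =>
      simp only [manyColorElem]
      split_ifs <;> omega
    | i + 4 =>
      simp only [manyColorElem]
      omega

/-- Equinumerous three-colourings contain rainbow progressions. -/
theorem rainbow_three {n : ℕ} (hn : 0 < n) (c : ℕ → Fin 3)
    (hc : ∀ x : Fin 3, ((Finset.Icc 1 (3 * n)).filter (fun i => c i = x)).card = n) :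
    RainbowAPk 3 (3 * n) c := by
  by_contra hcon
  have key : ∀ a d : ℕ, 1 ≤ a → 1 ≤ d → a + 2 * d ≤ 3 * n →
      c a = c (a + d) ∨ c (a + d) = c (a + 2 * d) ∨ c a = c (a + 2 * d) := by
    intro a d ha hd hle
    by_contra! hne
    refine hcon ⟨a, d, ha, hd, hle, ?_⟩
    intro i j hij
    fin_cases i <;> fin_cases j <;> simp_all [Ne.symm]
  have hfree : RainbowFree (fun x : ℤ => c x.toNat) 1 (3 * n) := by
    intro x y z hx hx' hz hz' hxyz
    rcases lt_trichotomy x z with hlt | heq | hlt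
    · have := key x.toNat (y - x).toNat (by omega) (by omega) (by omega)
      rwa [show x.toNat + (y - x).toNat = y.toNat by omega,
        show x.toNat + 2 * (y - x).toNat = z.toNat by omega] at this
    · exact Or.inr (Or.inr (by rw [heq]))
    · have := key z.toNat (y - z).toNat (by omega) (by omega) (by omega)
      rw [show z.toNat + (y - z).toNat = y.toNat by omega,
        show z.toNat + 2 * (y - z).toNat = x.toNat by omega] at this
      tauto
  refine hfree.not_equinumerous hn fun v => ?_
  refine Eq.trans ?_ (hc v)
  refine Finset.card_nbij' Int.toNat (fun i => (i : ℤ)) ?_ ?_ ?_ ?_ <;> intro i <;>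
    simp only [Finset.coe_filter, Set.mem_ofPred_eq, Finset.mem_Icc, Int.toNat_natCast,
      implies_true] <;> intro hi
  · exact ⟨⟨by omega, by omega⟩, hi.2⟩
  · exact ⟨⟨by omega, by omega⟩, hi.2⟩
  · omega

theorem stmt_19 (k n : ℕ) (hk : 3 ≤ k) (hn : 1 < n) :
    (∀ c : ℕ → Fin k,
        (∀ x : Fin k, ((Finset.Icc 1 (k*n)).filter (fun i => c i = x)).card = n) →
        RainbowAPk k (k*n) c) ↔ k = 3 := by
  constructor
  · intro h
    by_contra hk3
    obtain ⟨c, hc, hc'⟩ : ∃ c : ℕ → Fin k,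
        (∀ x : Fin k, ((Finset.Icc 1 (k * n)).filter (fun i => c i = x)).card = n) ∧
          ¬ RainbowAPk k (k * n) c := by
      rcases Nat.lt_or_ge k 5 with hk5 | hk5
      · obtain rfl : k = 4 := by omega
        exact exists_four_coloring hn
      · exact exists_many_coloring hk5 hn
    exact hc' (h c hc)
  · rintro rfl
    exact rainbow_three (by omega)
end
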